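/- Let Ω = {ω₁, …, ωₙ} be a finite nonempty set and π : Ω → ℝ with 0 ≤ π(ω) ≤ 1 for all ω. For each ω ∈ Ω let s_ω be the simple mass function assigning mass 1 − π(ω) to Ω \ {ω} and mass π(ω) to Ω. Then the iterated conjunctive combination of the s_ω over all ω ∈ Ω equals the poss-transferable mass function: for every F ⊆ Ω, (⊓_{ω ∈ Ω} s_ω)(F) = ∏_{ω ∈ F} π(ω) · ∏_{ω ∉ F} (1 − π(ω)). -/

import Mathlib

open Finset

/-- The conjunctive combination rule: `(m₁⊓m₂)(F) = Σ_{A ∩ B = F} m₁(A)·m₂(B)`. -/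
def ccr {Ω : Type*} [Fintype Ω] [DecidableEq Ω] (m₁ m₂ : Finset Ω → ℝ)
    (F : Finset Ω) : ℝ :=
  ∑ p ∈ Finset.univ.filter (fun p : Finset Ω × Finset Ω => p.1 ∩ p.2 = F),
    m₁ p.1 * m₂ p.2

/-- The simple mass function assigning mass `1 - π(ω)` to `Ω \ {ω}` and mass `π(ω)` to `Ω`. -/
def simpleMass {Ω : Type*} [Fintype Ω] [DecidableEq Ω] (π : Ω → ℝ) (ω : Ω)
    (F : Finset Ω) : ℝ :=
  if F = Finset.univ \ {ω} then 1 - π ω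
  else if F = Finset.univ then π ω
  else 0

/-- The vacuous mass function (the neutral element of the CCR). -/
def vacuous {Ω : Type*} [Fintype Ω] [DecidableEq Ω] (F : Finset Ω) : ℝ :=
  if F = Finset.univ then 1 else 0

/-- The poss-transferable mass function of `ρ`. -/
def possTransferable {Ω : Type*} [Fintype Ω] [DecidableEq Ω] (ρ : Ω → ℝ) (F : Finset Ω) : ℝ :=
  (∏ ω ∈ F, ρ ω) * ∏ ω ∈ Fᶜ, (1 - ρ ω)

theorem vacuous_eq_possTransferable {Ω : Type*} [Fintype Ω] [DecidableEq Ω] :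
    vacuous = possTransferable (fun _ : Ω => 1) := by
  funext F
  simp [vacuous, possTransferable, Finset.prod_const, zero_pow_eq]

theorem possTransferable_insert {Ω : Type*} [Fintype Ω] [DecidableEq Ω] (ρ : Ω → ℝ) {ω : Ω}
    {G : Finset Ω} (h : ω ∉ G) :
    possTransferable ρ (insert ω G) =
      ρ ω * ((∏ x ∈ G, ρ x) * ∏ x ∈ (insert ω G)ᶜ, (1 - ρ x)) := by
  rw [possTransferable, Finset.prod_insert h, mul_assoc]

theorem possTransferable_of_notMem {Ω : Type*} [Fintype Ω] [DecidableEq Ω] (ρ : Ω → ℝ) {ω : Ω}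
    {G : Finset Ω} (h : ω ∉ G) :
    possTransferable ρ G =
      (1 - ρ ω) * ((∏ x ∈ G, ρ x) * ∏ x ∈ (insert ω G)ᶜ, (1 - ρ x)) := by
  have hG : insert ω (insert ω G)ᶜ = Gᶜ := Finset.insert_compl_insert h
  rw [possTransferable, ← hG, Finset.prod_insert (by simp)]
  ring

/-- Conjunctive combination with a simple mass function. -/
theorem ccr_simpleMass {Ω : Type*} [Fintype Ω] [DecidableEq Ω] (π : Ω → ℝ) (ω : Ω)
    (m : Finset Ω → ℝ) (F : Finset Ω) :
    ccr (simpleMass π ω) m F =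
      (1 - π ω) * (∑ B : Finset Ω, if B.erase ω = F then m B else 0) + π ω * m F := by
  have hne : (Finset.univ : Finset Ω) ≠ Finset.univ \ {ω} := fun h => by
    have := Finset.mem_univ ω
    rw [h] at this
    simp at this
  have hmass (A : Finset Ω) : simpleMass π ω A =
      (if A = Finset.univ \ {ω} then 1 - π ω else 0) +
        (if A = Finset.univ then π ω else 0) := by
    unfold simpleMass
    split_ifs <;> simp_all
  have hinter (B : Finset Ω) : (Finset.univ \ {ω}) ∩ B = B.erase ω := by
    ext x
    simp
  rw [ccr, Finset.sum_filter, Fintype.sum_prod_type_right]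
  have hB (B : Finset Ω) :
      (∑ A : Finset Ω, if A ∩ B = F then simpleMass π ω A * m B else 0) =
        (1 - π ω) * (if B.erase ω = F then m B else 0) + if B = F then π ω * m B else 0 := by
    have (A : Finset Ω) : (if A ∩ B = F then simpleMass π ω A * m B else 0) =
        (if A = Finset.univ \ {ω} then (if A ∩ B = F then (1 - π ω) * m B else 0) else 0) +
          (if A = Finset.univ then (if A ∩ B = F then π ω * m B else 0) else 0) := by
      rw [hmass]
      split_ifs <;> ring
    simp only [this, Finset.sum_add_distrib, Finset.sum_ite_eq', Finset.mem_univ, if_true,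
      hinter, Finset.univ_inter, mul_ite, mul_zero]
  simp only [hB, Finset.sum_add_distrib, ← Finset.mul_sum, Finset.sum_ite_eq', Finset.mem_univ,
    if_true]

theorem sum_erase_eq_of_notMem {Ω : Type*} [Fintype Ω] [DecidableEq Ω] (m : Finset Ω → ℝ)
    {ω : Ω} {F : Finset Ω} (h : ω ∉ F) :
    (∑ B : Finset Ω, if B.erase ω = F then m B else 0) = m F + m (insert ω F) := by
  have hfilter : Finset.univ.filter (fun B : Finset Ω => B.erase ω = F) = {F, insert ω F} := by
    ext B
    simp only [Finset.mem_filter, Finset.mem_univ, true_and, Finset.mem_insert,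
      Finset.mem_singleton]
    constructor
    · rintro rfl
      by_cases hB : ω ∈ B
      · exact Or.inr (Finset.insert_erase hB).symm
      · exact Or.inl (Finset.erase_eq_of_notMem hB).symm
    · rintro (rfl | rfl)
      · exact Finset.erase_eq_of_notMem h
      · exact Finset.erase_insert h
  rw [← Finset.sum_filter, hfilter, Finset.sum_pair]
  exact fun h' => h (h' ▸ Finset.mem_insert_self ω F)

/-- Combining with a simple mass function multiplies the possibility of one point. -/
theorem ccr_simpleMass_possTransferable {Ω : Type*} [Fintype Ω] [DecidableEq Ω] (π ρ : Ω → ℝ)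
    (ω : Ω) :
    ccr (simpleMass π ω) (possTransferable ρ) =
      possTransferable (Function.update ρ ω (π ω * ρ ω)) := by
  have hupd {G : Finset Ω} (hG : ω ∉ G) (f : ℝ → ℝ) :
      ∏ x ∈ G, f (Function.update ρ ω (π ω * ρ ω) x) = ∏ x ∈ G, f (ρ x) :=
    Finset.prod_congr rfl fun x hx => by
      rw [Function.update_of_ne (ne_of_mem_of_not_mem hx hG)]
  funext F
  rw [ccr_simpleMass]
  by_cases h : ω ∈ F
  · obtain ⟨G, hG, rfl⟩ : ∃ G, ω ∉ G ∧ insert ω G = F :=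
      ⟨F.erase ω, Finset.notMem_erase ω F, Finset.insert_erase h⟩
    have hzero : (∑ B : Finset Ω, if B.erase ω = insert ω G then possTransferable ρ B else 0) = 0 :=
      Finset.sum_eq_zero fun B _ =>
        if_neg fun hB : B.erase ω = insert ω G => Finset.notMem_erase ω B (hB ▸ h)
    rw [hzero, possTransferable_insert _ hG, possTransferable_insert _ hG, hupd hG (fun y => y),
      hupd (by simp) (fun y => 1 - y), Function.update_self]
    ring
  · rw [sum_erase_eq_of_notMem _ h, possTransferable_insert _ h, possTransferable_of_notMem _ h,
      possTransferable_of_notMem _ h, hupd h (fun y => y), hupd (by simp) (fun y => 1 - y),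
      Function.update_self]
    ring

theorem foldr_ccr_simpleMass {Ω : Type*} [Fintype Ω] [DecidableEq Ω] (π : Ω → ℝ) (l : List Ω) :
    (l.map (simpleMass π)).foldr ccr vacuous =
      possTransferable (fun ω => π ω ^ l.count ω) := by
  induction l with
  | nil => simp [vacuous_eq_possTransferable]
  | cons ω l ih =>
    rw [List.map_cons, List.foldr_cons, ih, ccr_simpleMass_possTransferable]
    congr 1
    funext x
    by_cases h : x = ω
    · subst h
      simp [pow_succ']
    · simp [h, List.count_cons_of_ne (Ne.symm h)]

/-- The iterated conjunctive combination of the simple mass functions `(Ω \ {ω})^{π(ω)}`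
over all `ω ∈ Ω` equals the poss-transferable mass function. -/
theorem iterated_ccr_simple_eq_possTransferable
    {Ω : Type*} [Fintype Ω] [DecidableEq Ω] [Nonempty Ω]
    (π : Ω → ℝ) (hπ : ∀ ω, 0 ≤ π ω ∧ π ω ≤ 1) :
    ∀ F : Finset Ω,
      ((Finset.univ.toList.map (simpleMass π)).foldr ccr vacuous) F =
        (∏ ω ∈ F, π ω) * ∏ ω ∈ Fᶜ, (1 - π ω) := by
  intro F
  have hcount (ω : Ω) : (Finset.univ : Finset Ω).toList.count ω = 1 :=
    List.count_eq_one_of_mem (Finset.nodup_toList _) (by simp)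
  simp only [foldr_ccr_simpleMass, hcount, pow_one, possTransferable]
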